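/- Let k₁ = 2, 2 ≤ t ≤ min(k₂, d), and let (u,v) be integers with 1 ≤ u ≤ v ≤ k₂ − t + 1 (and u + v = k₂ if t = 2). Let S = {1}×{1,…,u} ∪ {2}×{k₂−v+1,…,k₂}, and let J_S ⊆ ℂ[X] be the ideal generated by F(J_S) = ⋃_{j : C_j ∩ S = ∅} F_2(X_{C_j}) ∪ F_{t−1}(X_{𝒞(S)}) ∪ F_t(X_{(R₁∖S) ∪ 𝒞(S)}) ∪ F_t(X_{(R₂∖S) ∪ 𝒞(S)}). Then F(J_S) is a Gröbner basis of J_S with respect to the lexicographic order ≺. -/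

import Mathlib

noncomputable section

open MvPolynomial

namespace CI

/-- The column index set `[k₁] × [k₂]`. -/
abbrev Col (k₁ k₂ : ℕ) := Fin k₁ × Fin k₂

/-- The polynomial ring `ℂ[X]` in the entries of the `d × (k₁k₂)` matrix `X` of
indeterminates `x_{i,(j,ℓ)}`. -/
abbrev MvP (d k₁ k₂ : ℕ) := MvPolynomial (Fin d × Col k₁ k₂) ℂ

/-- The `r × r` minor of `X` with rows `a` and columns `b`. -/
def minorPoly (d k₁ k₂ r : ℕ) (a : Fin r → Fin d) (b : Fin r → Col k₁ k₂) :
    MvP d k₁ k₂ :=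
  (Matrix.of fun i j => (X (a i, b j) : MvP d k₁ k₂)).det

/-- `F_r(X_U)`: the set of all `r × r` minors of the submatrix `X_U`. -/
def minorSet (d k₁ k₂ r : ℕ) (U : Set (Col k₁ k₂)) : Set (MvP d k₁ k₂) :=
  { f | ∃ a : Fin r → Fin d, ∃ b : Fin r → Col k₁ k₂,
      Function.Injective a ∧ Function.Injective b ∧ (∀ i, b i ∈ U) ∧
      f = minorPoly d k₁ k₂ r a b }

/-- `I_r(X_U)`: the ideal generated by the `r × r` minors of `X_U`. -/
def minorIdeal (d k₁ k₂ r : ℕ) (U : Set (Col k₁ k₂)) : Ideal (MvP d k₁ k₂) :=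
  Ideal.span (minorSet d k₁ k₂ r U)

/-- The row slice `R_i = {i} × [k₂]`. -/
def rowSlice (k₁ k₂ : ℕ) (i : Fin k₁) : Set (Col k₁ k₂) := { p | p.1 = i }

/-- The column slice `C_j = [k₁] × {j}`. -/
def colSlice (k₁ k₂ : ℕ) (j : Fin k₂) : Set (Col k₁ k₂) := { p | p.2 = j }

/-- The conditional independence ideal `𝓘_C = Σ_j I_2(X_{C_j}) + Σ_i I_t(X_{R_i})`. -/
def ciIdeal (d k₁ k₂ t : ℕ) : Ideal (MvP d k₁ k₂) :=
  (⨆ j : Fin k₂, minorIdeal d k₁ k₂ 2 (colSlice k₁ k₂ j)) ⊔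
    ⨆ i : Fin k₁, minorIdeal d k₁ k₂ t (rowSlice k₁ k₂ i)

/-- `I_∅ = I_t(X) + Σ_j I_2(X_{C_j})`. -/
def Iempty (d k₁ k₂ t : ℕ) : Ideal (MvP d k₁ k₂) :=
  minorIdeal d k₁ k₂ t Set.univ ⊔
    ⨆ j : Fin k₂, minorIdeal d k₁ k₂ 2 (colSlice k₁ k₂ j)

/-! ### The case `k₁ = 2`: the ideals `I_S` -/

/-- The column slice `C_j` does not meet `S`. -/
def colOK (k₂ : ℕ) (S : Set (Col 2 k₂)) (j : Fin k₂) : Prop := ∀ i : Fin 2, (i, j) ∉ S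

/-- `𝒞(S)`: the union of all column slices not meeting `S`. -/
def CSet (k₂ : ℕ) (S : Set (Col 2 k₂)) : Set (Col 2 k₂) := { p | colOK k₂ S p.2 }

/-- The condition `Z(1,S) ∖ Z(2,S) ≠ ∅` and `Z(2,S) ∖ Z(1,S) ≠ ∅` under which the
`(t-1)`-minors are included in `F_S`. -/
def tCond (k₂ : ℕ) (S : Set (Col 2 k₂)) : Prop :=
  (∃ ℓ, ((0 : Fin 2), ℓ) ∈ S ∧ ((1 : Fin 2), ℓ) ∉ S) ∧
  (∃ ℓ, ((1 : Fin 2), ℓ) ∈ S ∧ ((0 : Fin 2), ℓ) ∉ S)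

/-- The generating set `F_S` of the ideal `I_S` (for `k₁ = 2`). -/
def FSset (d k₂ t : ℕ) (S : Set (Col 2 k₂)) : Set (MvP d 2 k₂) :=
  minorSet d 2 k₂ 1 S ∪
  (⋃ j ∈ { j : Fin k₂ | colOK k₂ S j }, minorSet d 2 k₂ 2 (colSlice 2 k₂ j)) ∪
  (⋃ _ : tCond k₂ S, minorSet d 2 k₂ (t - 1) (CSet k₂ S)) ∪
  minorSet d 2 k₂ t ((rowSlice 2 k₂ 0 \ S) ∪ CSet k₂ S) ∪
  minorSet d 2 k₂ t ((rowSlice 2 k₂ 1 \ S) ∪ CSet k₂ S)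

/-- The ideal `I_S ⊆ ℂ[X]` for `S ⊆ [2] × [k₂]`, generated by `F_S`. -/
def ISIdeal (d k₂ t : ℕ) (S : Set (Col 2 k₂)) : Ideal (MvP d 2 k₂) :=
  Ideal.span (FSset d k₂ t S)

/-- `u = min(|R₁ ∩ S|, |R₂ ∩ S|)`, the first entry of the combinatorial type of `S`. -/
def uOf (k₂ : ℕ) (S : Set (Col 2 k₂)) : ℕ :=
  min ((rowSlice 2 k₂ 0 ∩ S).ncard) ((rowSlice 2 k₂ 1 ∩ S).ncard)

/-- `v = max(|R₁ ∩ S|, |R₂ ∩ S|)`, the second entry of the combinatorial type of `S`. -/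
def vOf (k₂ : ℕ) (S : Set (Col 2 k₂)) : ℕ :=
  max ((rowSlice 2 k₂ 0 ∩ S).ncard) ((rowSlice 2 k₂ 1 ∩ S).ncard)

/-- `S` contains no column slice. -/
def noColumn (k₂ : ℕ) (S : Set (Col 2 k₂)) : Prop :=
  ∀ j : Fin k₂, ¬ colSlice 2 k₂ j ⊆ S

/-- A subset `S ⊆ [2] × [k₂]` is minimal: `S = ∅`, or `S` contains no column slice,
its combinatorial type `(u,v)` satisfies `1 ≤ u ≤ v ≤ k₂ - t + 1`, and `u + v = k₂`
in case `t = 2`. -/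
def minimalSubset (k₂ t : ℕ) (S : Set (Col 2 k₂)) : Prop :=
  S = ∅ ∨ (noColumn k₂ S ∧ 1 ≤ uOf k₂ S ∧ uOf k₂ S ≤ vOf k₂ S ∧
    vOf k₂ S ≤ k₂ - t + 1 ∧ (t = 2 → uOf k₂ S + vOf k₂ S = k₂))

/-! ### Hypergraphs and their closure -/

/-- The hypergraph `H(S)` on `[k₁] × [k₂]`: its hyperedges are (1) the singletons of
elements of `S`; (2) the 2-subsets of a column slice disjoint from `S`; (3) the
`(t-1)`-subsets of `{i,j} × (NZ(i,S) ∩ NZ(j,S))` for distinct rows `i, j` with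
`Z(i,S) ∖ Z(j,S) ≠ ∅` and `Z(j,S) ∖ Z(i,S) ≠ ∅`; (4) the `t`-subsets of a row slice
disjoint from `S`. -/
def HS (k₁ k₂ t : ℕ) (S : Set (Col k₁ k₂)) : Set (Finset (Col k₁ k₂)) :=
  { e | (∃ p ∈ S, e = {p})
      ∨ (e.card = 2 ∧ (∃ j, ∀ p ∈ e, p.2 = j) ∧ ∀ p ∈ e, p ∉ S)
      ∨ (e.card = t - 1 ∧ ∃ i j : Fin k₁, i ≠ j ∧
           (∃ ℓ, (i, ℓ) ∈ S ∧ (j, ℓ) ∉ S) ∧ (∃ ℓ, (j, ℓ) ∈ S ∧ (i, ℓ) ∉ S) ∧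
           ∀ p ∈ e, (p.1 = i ∨ p.1 = j) ∧ (i, p.2) ∉ S ∧ (j, p.2) ∉ S)
      ∨ (e.card = t ∧ (∃ i, ∀ p ∈ e, p.1 = i) ∧ ∀ p ∈ e, p ∉ S) }

/-- The closure of a hypergraph: iterate the rule "if `{a,b}` and `e` (with `a ∈ e`)
are hyperedges, then add `(e ∖ {a}) ∪ {b}`". -/
inductive HClosure {k₁ k₂ : ℕ} (H : Set (Finset (Col k₁ k₂))) :
    Finset (Col k₁ k₂) → Prop
  | base {e : Finset (Col k₁ k₂)} : e ∈ H → HClosure H e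
  | step {e : Finset (Col k₁ k₂)} (a b : Col k₁ k₂) :
      a ∈ e → HClosure H {a, b} → HClosure H e → HClosure H (insert b (e.erase a))

/-- The determinantal ideal of a hypergraph: it is generated by the minors `[A|B]`
with `A ⊆ [d]`, `B` a hyperedge, and `|A| = |B|`. -/
def hypIdeal (d k₁ k₂ : ℕ) (H : Set (Finset (Col k₁ k₂))) : Ideal (MvP d k₁ k₂) :=
  Ideal.span { f | ∃ e ∈ H, ∃ a : Fin e.card → Fin d, ∃ b : Fin e.card → Col k₁ k₂,
      Function.Injective a ∧ Function.Injective b ∧ (∀ i, b i ∈ e) ∧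
      f = minorPoly d k₁ k₂ e.card a b }

/-- The ideal `I_S` associated to the closure of the hypergraph `H(S)`. -/
def ISclosure (d k₁ k₂ t : ℕ) (S : Set (Col k₁ k₂)) : Ideal (MvP d k₁ k₂) :=
  hypIdeal d k₁ k₂ { e | HClosure (HS k₁ k₂ t S) e }

/-! ### The lexicographic monomial order -/

/-- `varLT a b` means the variable `x_a` is *larger* than `x_b` in the variable order
`x_{1,(1,1)} > x_{2,(1,1)} > ⋯ > x_{d,(1,1)} > x_{1,(2,1)} > ⋯ > x_{d,(k₁,k₂)}`,
i.e. `(ℓ, j, i)` precedes `(ℓ', j', i')` lexicographically, where `a = (i, (j, ℓ))`. -/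
def varLT (d k₁ k₂ : ℕ) (a b : Fin d × Col k₁ k₂) : Prop :=
  Prod.Lex (· < ·) (Prod.Lex (· < ·) (· < ·))
    (a.2.2, (a.2.1, a.1)) (b.2.2, (b.2.1, b.1))

/-- `m ≺ m'` in the lexicographic monomial order determined by the variable order:
at the largest variable where the exponents differ, `m` has the smaller exponent. -/
def monLT (d k₁ k₂ : ℕ) (m m' : (Fin d × Col k₁ k₂) →₀ ℕ) : Prop :=
  ∃ v, (∀ w, varLT d k₁ k₂ w v → m w = m' w) ∧ m v < m' v

/-- `m` is the `≺`-leading monomial of `f`. -/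
def IsLeadMon (d k₁ k₂ : ℕ) (f : MvP d k₁ k₂) (m : (Fin d × Col k₁ k₂) →₀ ℕ) : Prop :=
  m ∈ f.support ∧ ∀ m' ∈ f.support, m' = m ∨ monLT d k₁ k₂ m' m

/-- `G` is a Gröbner basis of `I` with respect to the lexicographic order `≺`:
`G` is contained in `I` and for every nonzero `f ∈ I` there is a `g ∈ G` whose
`≺`-leading monomial divides the `≺`-leading monomial of `f`. -/
def IsGB (d k₁ k₂ : ℕ) (G : Set (MvP d k₁ k₂)) (I : Ideal (MvP d k₁ k₂)) : Prop :=
  G ⊆ (I : Set (MvP d k₁ k₂)) ∧ ∀ f ∈ I, f ≠ 0 →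
    ∃ g ∈ G, ∃ mg, IsLeadMon d k₁ k₂ g mg ∧
      ∀ mf, IsLeadMon d k₁ k₂ f mf → ∀ x, mg x ≤ mf x

/-! ### The matrix `D_A` -/

/-- For `A ∈ ℂ^{k₂ × (k₁-1)}`, the `k₂ × (k₁k₂)` matrix `D_A`: its row `r` has entry
`1` in the column indexed by `(1, r)`, entry `A r ℓ` in the column indexed by
`(1+ℓ, r)` for `ℓ ∈ [k₁-1]`, and zeros elsewhere. -/
def DMat (k₁ k₂ : ℕ) (A : Matrix (Fin k₂) (Fin (k₁ - 1)) ℂ) :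
    Matrix (Fin k₂) (Col k₁ k₂) ℂ := fun r c =>
  if c.2 = r then
    (if _h : (c.1 : ℕ) = 0 then 1
     else A r ⟨(c.1 : ℕ) - 1, by have := c.1.isLt; omega⟩)
  else 0

end CI

namespace CI

/-- The strict order on cells: `x` lies strictly above and strictly to the left of `y`. -/
def NW (x y : ℕ × ℕ) : Prop := x.1 < y.1 ∧ x.2 < y.2

/-- A finite set of cells any two of which are strictly comparable. -/
def NWChain (C : Finset (ℕ × ℕ)) : Prop := ∀ x ∈ C, ∀ y ∈ C, x ≠ y → NW x y ∨ NW y x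

lemma NWChain.subset {C D : Finset (ℕ × ℕ)} (h : NWChain D) (hCD : C ⊆ D) : NWChain C :=
  fun x hx y hy hxy => h x (hCD hx) y (hCD hy) hxy

lemma NWChain.insert_of_forall_NW {C : Finset (ℕ × ℕ)} {x : ℕ × ℕ} (h : NWChain C)
    (hx : ∀ y ∈ C, NW y x) : NWChain (insert x C) := by
  intro y hy z hz hyz
  rw [Finset.mem_insert] at hy hz
  rcases hy with rfl | hy <;> rcases hz with rfl | hz
  · exact absurd rfl hyz
  · exact Or.inr (hx z hz)
  · exact Or.inl (hx y hy)
  · exact h y hy z hz hyz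

open Classical in
/-- The largest cardinality of a chain of cells of `G`. -/
def maxChain (G : Finset (ℕ × ℕ)) : ℕ := (G.powerset.filter NWChain).sup Finset.card

open Classical in
lemma NWChain.card_le_maxChain {G C : Finset (ℕ × ℕ)} (h : NWChain C) (hC : C ⊆ G) :
    C.card ≤ maxChain G :=
  Finset.le_sup (f := Finset.card)
    (Finset.mem_filter.2 ⟨Finset.mem_powerset.2 hC, h⟩)

open Classical in
lemma exists_NWChain_card_eq_maxChain (G : Finset (ℕ × ℕ)) :
    ∃ C ⊆ G, NWChain C ∧ C.card = maxChain G := by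
  obtain ⟨C, hC, h⟩ := Finset.exists_mem_eq_sup (G.powerset.filter NWChain)
    ⟨∅, by simp [NWChain]⟩ Finset.card
  rw [Finset.mem_filter, Finset.mem_powerset] at hC
  exact ⟨C, hC.1, hC.2, by rw [maxChain, h]⟩

open Classical in
/-- The largest cardinality of a chain of cells of `G` strictly north-west of `x`. -/
def height (G : Finset (ℕ × ℕ)) (x : ℕ × ℕ) : ℕ := maxChain (G.filter (NW · x))

lemma exists_NWChain_card_eq_height_succ (G : Finset (ℕ × ℕ)) {x : ℕ × ℕ} (hx : x ∈ G) :
    ∃ C ⊆ G, NWChain C ∧ (∀ y ∈ C, y = x ∨ NW y x) ∧ C.card = height G x + 1 := by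
  classical
  obtain ⟨C, hC, hch, hcard⟩ := exists_NWChain_card_eq_maxChain (G.filter (NW · x))
  have hC' : ∀ y ∈ C, y ∈ G ∧ NW y x := fun y hy => Finset.mem_filter.1 (hC hy)
  have hxC : x ∉ C := fun h => lt_irrefl _ (hC' x h).2.1
  refine ⟨insert x C, ?_, hch.insert_of_forall_NW fun y hy => (hC' y hy).2, ?_, ?_⟩
  · exact Finset.insert_subset hx fun y hy => (hC' y hy).1
  · intro y hy
    exact (Finset.mem_insert.1 hy).imp_right fun h => (hC' y h).2
  · rw [Finset.card_insert_of_notMem hxC, hcard, height]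

lemma height_lt_height {G : Finset (ℕ × ℕ)} {x y : ℕ × ℕ} (hx : x ∈ G) (hxy : NW x y) :
    height G x < height G y := by
  classical
  obtain ⟨C, hC, hch, hle, hcard⟩ := exists_NWChain_card_eq_height_succ G hx
  have : C.card ≤ maxChain (G.filter (NW · y)) := by
    refine hch.card_le_maxChain fun z hz => Finset.mem_filter.2 ⟨hC hz, ?_⟩
    rcases hle z hz with rfl | h
    · exact hxy
    · exact ⟨h.1.trans hxy.1, h.2.trans hxy.2⟩
  rw [height, height] at *
  omega

/-- A chain `Y` and a chain `P` in the columns `lo ≤ · < hi` can be cut along a column and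
recombined into a chain left of `hi` and a chain right of `lo`. -/
lemma NWChain.exchange {lo hi : ℕ} (hlh : lo ≤ hi) {Y P : Finset (ℕ × ℕ)} (hY : NWChain Y)
    (hP : NWChain P) (hPM : ∀ p ∈ P, lo ≤ p.2 ∧ p.2 < hi) :
    ∃ C D : Finset (ℕ × ℕ), C ⊆ Y ∪ P ∧ D ⊆ Y ∪ P ∧ NWChain C ∧ NWChain D ∧
      (∀ x ∈ C, x.2 < hi) ∧ (∀ x ∈ D, lo ≤ x.2) ∧ Y.card + P.card = C.card + D.card := by
  classical
  obtain ⟨κ, hκlo, hκhi, h₁, h₂⟩ : ∃ κ, lo ≤ κ ∧ κ ≤ hi ∧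
      (∀ y ∈ Y, ∀ p ∈ P, y.2 < κ → κ ≤ p.2 → y.1 < p.1) ∧
      (∀ y ∈ Y, ∀ p ∈ P, κ ≤ y.2 → p.2 < κ → p.1 < y.1) := by
    set A := P.filter fun p => ∃ y ∈ Y, y.2 < hi ∧ p.1 ≤ y.1 ∧ y.2 ≤ p.2 with hA
    have hmemA : ∀ y ∈ Y, ∀ p ∈ P, y.2 < hi → y.2 ≤ p.2 → p ∉ A → y.1 < p.1 := by
      intro y hy p hp hyhi hyp hpA
      by_contra hcon
      exact hpA (Finset.mem_filter.2 ⟨hp, y, hy, hyhi, not_lt.1 hcon, hyp⟩)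
    rcases A.eq_empty_or_nonempty with hAe | hAn
    · refine ⟨lo, le_rfl, hlh, ?_, ?_⟩
      · intro y hy p hp h h'
        exact hmemA y hy p hp (by omega) (by omega) (by simp [hAe])
      · intro y _ p hp _ h'
        have := (hPM p hp).1
        omega
    · obtain ⟨p₀, hp₀, hmax⟩ := A.exists_max_image Prod.snd hAn
      obtain ⟨hp₀P, y₀, hy₀, hy₀hi, hrow, hcol⟩ := Finset.mem_filter.1 hp₀
      have hM := hPM p₀ hp₀P
      refine ⟨p₀.2 + 1, by omega, by omega, ?_, ?_⟩
      · intro y hy p hp h h'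
        refine hmemA y hy p hp (by omega) (by omega) fun hpA => ?_
        have := hmax p hpA
        omega
      · intro y hy p hp h h'
        have hpp : p.1 ≤ p₀.1 := by
          by_cases hpe : p = p₀
          · rw [hpe]
          · rcases hP p hp p₀ hp₀P hpe with h3 | h3
            · exact h3.1.le
            · have := h3.2
              omega
        have hyy : y₀.1 < y.1 := by
          rcases hY y₀ hy₀ y hy (fun he => by rw [he] at hcol; omega) with h3 | h3
          · exact h3.1
          · have := h3.2
            omega
        omega
  have glue : ∀ {s t : Finset (ℕ × ℕ)}, NWChain s → NWChain t →
      (∀ x ∈ s, ∀ y ∈ t, NW x y) → NWChain (s ∪ t) := by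
    intro s t hs ht hst x hx y hy hxy
    rcases Finset.mem_union.1 hx with hx | hx <;> rcases Finset.mem_union.1 hy with hy | hy
    · exact hs x hx y hy hxy
    · exact Or.inl (hst x hx y hy)
    · exact Or.inr (hst y hy x hx)
    · exact ht x hx y hy hxy
  refine ⟨Y.filter (·.2 < κ) ∪ P.filter (¬ ·.2 < κ), P.filter (·.2 < κ) ∪ Y.filter (¬ ·.2 < κ),
    ?_, ?_, ?_, ?_, ?_, ?_, ?_⟩
  · exact Finset.union_subset_union (Finset.filter_subset _ _) (Finset.filter_subset _ _)
  · rw [Finset.union_comm Y P]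
    exact Finset.union_subset_union (Finset.filter_subset _ _) (Finset.filter_subset _ _)
  · refine glue (hY.subset (Finset.filter_subset _ _)) (hP.subset (Finset.filter_subset _ _)) ?_
    intro x hx y hy
    rw [Finset.mem_filter] at hx hy
    exact ⟨h₁ x hx.1 y hy.1 hx.2 (not_lt.1 hy.2), by omega⟩
  · refine glue (hP.subset (Finset.filter_subset _ _)) (hY.subset (Finset.filter_subset _ _)) ?_
    intro x hx y hy
    rw [Finset.mem_filter] at hx hy
    exact ⟨h₂ y hy.1 x hx.1 (not_lt.1 hy.2) hx.2, by omega⟩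
  · intro x hx
    rw [Finset.mem_union, Finset.mem_filter, Finset.mem_filter] at hx
    rcases hx with hx | hx
    · omega
    · exact (hPM x hx.1).2
  · intro x hx
    rw [Finset.mem_union, Finset.mem_filter, Finset.mem_filter] at hx
    rcases hx with hx | hx
    · exact (hPM x hx.1).1
    · omega
  · have hdY := Finset.card_filter_add_card_filter_not (s := Y) (fun x => x.2 < κ)
    have hdP := Finset.card_filter_add_card_filter_not (s := P) (fun x => x.2 < κ)
    rw [Finset.card_union_of_disjoint, Finset.card_union_of_disjoint]
    · omega
    all_goals
      rw [Finset.disjoint_left]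
      intro x hx hx'
      exact (Finset.mem_filter.1 hx').2 (Finset.mem_filter.1 hx).2

/-- If the chains of `G` in the columns `lo ≤ · < hi`, left of `hi`, and right of `lo` have at most
`r`, `r + 1` and `r + 1` cells, then `G` has a strictly increasing level function whose values are
confined on each of the three groups of columns. -/
lemma exists_level (G : Finset (ℕ × ℕ)) {lo hi r : ℕ} (hlh : lo ≤ hi)
    (hM : ∀ C ⊆ G, NWChain C → (∀ x ∈ C, lo ≤ x.2 ∧ x.2 < hi) → C.card ≤ r)
    (hL : ∀ C ⊆ G, NWChain C → (∀ x ∈ C, x.2 < hi) → C.card ≤ r + 1)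
    (hR : ∀ C ⊆ G, NWChain C → (∀ x ∈ C, lo ≤ x.2) → C.card ≤ r + 1) :
    ∃ q, 1 ≤ q ∧ ∃ lam : ℕ × ℕ → ℕ, (∀ x ∈ G, ∀ y ∈ G, NW x y → lam x < lam y) ∧
      ∀ x ∈ G, (x.2 < lo → lam x < r + 1) ∧
        (lo ≤ x.2 → x.2 < hi → q ≤ lam x ∧ lam x < r + 1) ∧
        (hi ≤ x.2 → q ≤ lam x ∧ lam x < r + 1 + q) := by
  classical
  obtain ⟨P, hPG, hP, hPcard⟩ :=
    exists_NWChain_card_eq_maxChain (G.filter fun x => lo ≤ x.2 ∧ x.2 < hi)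
  have hPM : ∀ p ∈ P, lo ≤ p.2 ∧ p.2 < hi := fun p hp => (Finset.mem_filter.1 (hPG hp)).2
  have hPG' : P ⊆ G := hPG.trans (Finset.filter_subset _ _)
  have hPr := hM P hPG' hP hPM
  set H := G.filter fun x => lo ≤ x.2 with hH
  have hHG : H ⊆ G := Finset.filter_subset _ _
  have hHlo : ∀ x ∈ H, lo ≤ x.2 := fun x hx => (Finset.mem_filter.1 hx).2
  refine ⟨r + 1 - P.card, by omega, fun x => if x.2 < lo then height G x else
    max (height G x) (r + 1 - P.card + height H x), ?_, ?_⟩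
  · intro x hx y hy hxy
    have h₁ := height_lt_height hx hxy
    have hcol := hxy.2
    dsimp only
    split_ifs with hxl hyl hyl
    · exact h₁
    · exact lt_max_of_lt_left h₁
    · omega
    · have h₂ : height H x < height H y :=
        height_lt_height (Finset.mem_filter.2 ⟨hx, not_lt.1 hxl⟩) hxy
      omega
  · intro x hx
    obtain ⟨C, hC, hch, hle, hcard⟩ := exists_NWChain_card_eq_height_succ G hx
    have hcolC : ∀ y ∈ C, y.2 ≤ x.2 := by
      intro y hy
      rcases hle y hy with rfl | h
      · exact le_rfl
      · exact h.2.le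
    dsimp only
    refine ⟨fun hlo => ?_, fun hlo hhi => ?_, fun hhi => ?_⟩
    · have := hL C hC hch fun y hy => by have := hcolC y hy; omega
      rw [if_pos hlo]
      omega
    all_goals
      have hxH : x ∈ H := Finset.mem_filter.2 ⟨hx, by omega⟩
      obtain ⟨D, hD, hchD, hleD, hcardD⟩ := exists_NWChain_card_eq_height_succ H hxH
      have hcolD : ∀ y ∈ D, y.2 ≤ x.2 := by
        intro y hy
        rcases hleD y hy with rfl | h
        · exact le_rfl
        · exact h.2.le
      rw [if_neg (by omega)]
    · have h₁ := hL C hC hch fun y hy => by have := hcolC y hy; omega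
      have h₂ : D.card ≤ P.card := by
        rw [hPcard]
        refine hchD.card_le_maxChain fun y hy => Finset.mem_filter.2 ⟨hHG (hD hy), ?_⟩
        have := hcolD y hy
        have := hHlo y (hD hy)
        omega
      omega
    · have h₁ := hR D (hD.trans hHG) hchD fun y hy => hHlo y (hD hy)
      obtain ⟨C₁, C₂, hC₁, hC₂, hch₁, hch₂, hcol₁, hcol₂, hsum⟩ := hch.exchange hlh hP hPM
      have hCP : C ∪ P ⊆ G := Finset.union_subset hC hPG'
      have h₂ := hL C₁ (hC₁.trans hCP) hch₁ hcol₁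
      have h₃ := hR C₂ (hC₂.trans hCP) hch₂ hcol₂
      omega

/-- A Monge array admits a dual potential that is tight on a prescribed set of cells containing
no two strictly comparable cells. -/
lemma exists_potential (W : ℕ → ℕ → ℝ)
    (hW : ∀ i c c', c ≤ c' → W i c' - W (i + 1) c' ≤ W i c - W (i + 1) c)
    (d : ℕ) (A : Finset (ℕ × ℕ)) (hA : ∀ x ∈ A, ∀ y ∈ A, ¬ NW x y) :
    ∃ α β : ℕ → ℝ, (∀ i < d, ∀ c, α i + β c ≤ W i c) ∧
      ∀ x ∈ A, x.1 < d → α x.1 + β x.2 = W x.1 x.2 := by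
  classical
  rcases Nat.eq_zero_or_pos d with rfl | hd
  · exact ⟨0, 0, by simp, by simp⟩
  set γ : ℕ → ℕ := fun s => (A.filter fun x => s < x.1).sup Prod.snd with hγ
  set α : ℕ → ℝ := fun i => - ∑ s ∈ Finset.range i, (W s (γ s) - W (s + 1) (γ s)) with hα
  have hα_succ : ∀ i, α i - α (i + 1) = W i (γ i) - W (i + 1) (γ i) := by
    intro i
    simp only [hα, Finset.sum_range_succ]
    ring
  have hne : (Finset.range d).Nonempty := ⟨0, Finset.mem_range.2 hd⟩
  set β : ℕ → ℝ := fun c => (Finset.range d).inf' hne fun i => W i c - α i with hβ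
  have hle : ∀ i < d, ∀ c, α i + β c ≤ W i c := by
    intro i hi c
    have : β c ≤ W i c - α i := Finset.inf'_le (fun i => W i c - α i) (Finset.mem_range.2 hi)
    linarith
  refine ⟨α, β, hle, fun x hx hxd => le_antisymm (hle _ hxd _) ?_⟩
  have hdown : ∀ n, W x.1 x.2 - α x.1 ≤ W (x.1 + n) x.2 - α (x.1 + n) := by
    intro n
    induction n with
    | zero => simp
    | succ n ih =>
      have hγle : γ (x.1 + n) ≤ x.2 := by
        refine Finset.sup_le fun y hy => ?_
        rw [Finset.mem_filter] at hy
        by_contra hcon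
        exact hA x hx y hy.1 ⟨by omega, not_le.1 hcon⟩
      have h₁ := hW (x.1 + n) _ _ hγle
      have h₂ := hα_succ (x.1 + n)
      rw [← add_assoc]
      linarith
  have hup : ∀ n ≤ x.1, W x.1 x.2 - α x.1 ≤ W (x.1 - n) x.2 - α (x.1 - n) := by
    intro n
    induction n with
    | zero => simp
    | succ n ih =>
      intro hn
      have ih := ih (by omega)
      have hγge : x.2 ≤ γ (x.1 - (n + 1)) :=
        Finset.le_sup (f := Prod.snd) (Finset.mem_filter.2 ⟨hx, by omega⟩)
      have h₁ := hW (x.1 - (n + 1)) _ _ hγge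
      have h₂ := hα_succ (x.1 - (n + 1))
      have h₃ : x.1 - (n + 1) + 1 = x.1 - n := by omega
      rw [h₃] at h₁ h₂
      linarith
  have : W x.1 x.2 - α x.1 ≤ β x.2 := by
    refine Finset.le_inf' hne _ fun i _ => ?_
    rcases le_total x.1 i with h | h
    · have := hdown (i - x.1)
      rwa [Nat.add_sub_cancel' h] at this
    · have := hup (x.1 - i) (by omega)
      rwa [Nat.sub_sub_self h] at this
  linarith

/-- The position of a variable in the variable order. -/
def varIdx (d k₂ : ℕ) (v : Fin d × Col 2 k₂) : ℕ := (2 * (v.2.2 : ℕ) + v.2.1) * d + v.1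

lemma varLT_iff (d k₂ : ℕ) (v w : Fin d × Col 2 k₂) :
    varLT d 2 k₂ v w ↔ varIdx d k₂ v < varIdx d k₂ w := by
  obtain ⟨i, j, l⟩ := v
  obtain ⟨i', j', l'⟩ := w
  have key : ∀ {a b x y : ℕ}, a < b → x < d → a * d + x < b * d + y := by
    intro a b x y hab hx
    have := Nat.mul_le_mul_right d (Nat.succ_le_of_lt hab)
    rw [Nat.succ_mul] at this
    omega
  simp only [varLT, varIdx, Prod.lex_def]
  have hj := j.isLt
  have hj' := j'.isLt
  rcases lt_trichotomy (2 * (l : ℕ) + j) (2 * (l' : ℕ) + j') with h | h | h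
  · have := key (y := i') h i.isLt
    simp only [Fin.lt_def, Fin.ext_iff]
    omega
  · rw [h]
    simp only [Fin.lt_def, Fin.ext_iff]
    omega
  · have := key (y := i) h i'.isLt
    simp only [Fin.lt_def, Fin.ext_iff]
    omega

lemma varIdx_injective (d k₂ : ℕ) : Function.Injective (varIdx d k₂) := by
  intro v w h
  by_contra hne
  have h₁ := (varLT_iff d k₂ v w).not.2 (by omega)
  have h₂ := (varLT_iff d k₂ w v).not.2 (by omega)
  obtain ⟨i, j, l⟩ := v
  obtain ⟨i', j', l'⟩ := w
  simp only [varLT, Prod.lex_def, Fin.lt_def, Fin.ext_iff, Prod.mk.injEq] at h₁ h₂ hne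
  omega

/-- For weights decaying fast enough along the variable order, `monLT` implies a strict inequality
of weights on a given finite set of monomials. -/
lemma exists_weight (d k₂ : ℕ) (s : Finset ((Fin d × Col 2 k₂) →₀ ℕ)) :
    ∃ δ : ℝ, 0 < δ ∧ δ ≤ 1 / 2 ∧ ∀ m ∈ s, ∀ m' ∈ s, monLT d 2 k₂ m m' →
      ∑ v, m v * δ ^ varIdx d k₂ v < ∑ v, m' v * δ ^ varIdx d k₂ v := by
  classical
  set B : ℝ := ∑ m ∈ s, ∑ v, (m v : ℝ) with hB
  have hB0 : 0 ≤ B := by positivity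
  have hBm : ∀ m ∈ s, ∑ v, (m v : ℝ) ≤ B := fun m hm =>
    Finset.single_le_sum (f := fun m : (Fin d × Col 2 k₂) →₀ ℕ => ∑ v, (m v : ℝ))
      (fun m _ => by positivity) hm
  have hδ0 : (0 : ℝ) < 1 / (B + 2) := by positivity
  have hδB : 1 / (B + 2) * B < 1 := by
    rw [one_div_mul_eq_div, div_lt_one (by positivity)]
    linarith
  have hδ2 : 1 / (B + 2) ≤ 1 / 2 := one_div_le_one_div_of_le (by norm_num) (by linarith)
  refine ⟨1 / (B + 2), hδ0, hδ2, ?_⟩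
  generalize 1 / (B + 2) = δ at hδ0 hδB hδ2
  rintro m hm m' - ⟨v₀, heq, hlt⟩
  set I := varIdx d k₂
  have hterm : ∀ v, (m v : ℝ) * δ ^ I v ≤
      m' v * δ ^ I v + (m v * δ ^ (I v₀ + 1) - if v = v₀ then δ ^ I v₀ else 0) := by
    intro v
    rcases lt_trichotomy (I v) (I v₀) with h | h | h
    · have hne : v ≠ v₀ := by rintro rfl; omega
      rw [heq v ((varLT_iff d k₂ v v₀).2 h), if_neg hne]
      have : 0 ≤ (m' v : ℝ) * δ ^ (I v₀ + 1) := by positivity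
      linarith
    · have := varIdx_injective d k₂ h
      subst this
      rw [if_pos rfl]
      have h1 : (m v : ℝ) + 1 ≤ m' v := by exact_mod_cast hlt
      have h2 : 0 ≤ (m v : ℝ) * δ ^ (I v + 1) := by positivity
      nlinarith [pow_pos hδ0 (I v)]
    · have hne : v ≠ v₀ := by rintro rfl; omega
      rw [if_neg hne]
      have h1 : δ ^ I v ≤ δ ^ (I v₀ + 1) :=
        pow_le_pow_of_le_one hδ0.le (by linarith) h
      have h2 : 0 ≤ (m' v : ℝ) * δ ^ I v := by positivity
      have h3 : (0 : ℝ) ≤ m v := by positivity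
      nlinarith [mul_le_mul_of_nonneg_left h1 h3]
  calc ∑ v, (m v : ℝ) * δ ^ I v
      ≤ ∑ v, (m' v * δ ^ I v + (m v * δ ^ (I v₀ + 1) - if v = v₀ then δ ^ I v₀ else 0)) :=
        Finset.sum_le_sum fun v _ => hterm v
    _ = ∑ v, m' v * δ ^ I v + ((∑ v, (m v : ℝ)) * δ ^ (I v₀ + 1) - δ ^ I v₀) := by
        rw [Finset.sum_add_distrib, Finset.sum_sub_distrib, Finset.sum_mul]
        simp
    _ < ∑ v, m' v * δ ^ I v := by
        have h1 := mul_le_mul_of_nonneg_right (hBm m hm) (pow_pos hδ0 (I v₀ + 1)).le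
        have h2 := mul_lt_mul_of_pos_right hδB (pow_pos hδ0 (I v₀))
        rw [pow_succ] at *
        nlinarith

/-- `monLT` is total. -/
lemma monLT_or_monLT_of_ne {d k₂ : ℕ} {m m' : (Fin d × Col 2 k₂) →₀ ℕ} (h : m ≠ m') :
    monLT d 2 k₂ m m' ∨ monLT d 2 k₂ m' m := by
  classical
  obtain ⟨v, hv, hmin⟩ := (Finset.univ.filter fun v => m v ≠ m' v).exists_min_image
    (varIdx d k₂) (by
      obtain ⟨v, hv⟩ := Finsupp.ne_iff.1 h
      exact ⟨v, by simpa using hv⟩)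
  have heq : ∀ w, varLT d 2 k₂ w v → m w = m' w := by
    intro w hw
    by_contra hne
    have := hmin w (by simpa using hne)
    rw [varLT_iff] at hw
    omega
  rcases lt_or_gt_of_ne (Finset.mem_filter.1 hv).2 with h | h
  · exact Or.inl ⟨v, heq, h⟩
  · exact Or.inr ⟨v, fun w hw => (heq w hw).symm, h⟩

/-- A nonzero polynomial has a leading monomial which is the unique heaviest monomial for
suitable weights `δ ^ varIdx`. -/
lemma exists_isLeadMon {d k₂ : ℕ} {f : MvP d 2 k₂} (hf : f ≠ 0) :
    ∃ m ∈ f.support, (∀ mf, IsLeadMon d 2 k₂ f mf → mf = m) ∧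
      ∃ δ : ℝ, 0 < δ ∧ δ ≤ 1 / 2 ∧ ∀ m' ∈ f.support, m' ≠ m →
        ∑ v, m' v * δ ^ varIdx d k₂ v < ∑ v, m v * δ ^ varIdx d k₂ v := by
  obtain ⟨δ, hδ0, hδ2, hδ⟩ := exists_weight d k₂ f.support
  obtain ⟨m, hm, hmax⟩ := f.support.exists_max_image
    (fun m => ∑ v, (m v : ℝ) * δ ^ varIdx d k₂ v) (support_nonempty.2 hf)
  have hlt : ∀ m' ∈ f.support, m' ≠ m → monLT d 2 k₂ m' m := by
    intro m' hm' hne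
    rcases monLT_or_monLT_of_ne hne with h | h
    · exact h
    · exact absurd (hmax m' hm') (not_le.2 (hδ m hm m' hm' h))
  refine ⟨m, hm, fun mf hmf => ?_, δ, hδ0, hδ2, fun m' hm' hne =>
    hδ m' hm' m hm (hlt m' hm' hne)⟩
  by_contra hne
  rcases hmf.2 m hm with h | h
  · exact hne h.symm
  · exact lt_asymm (hδ m hm mf hmf.1 h) (hδ mf hmf.1 m hm (hlt mf hmf.1 hne))

/-- The leading monomial of a minor is the product of its diagonal. -/
lemma isLeadMon_minorPoly {d k₂ r : ℕ} {a : Fin r → Fin d} {b : Fin r → Col 2 k₂}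
    (ha : StrictMono a) (hb : StrictMono fun k => 2 * ((b k).2 : ℕ) + (b k).1) :
    IsLeadMon d 2 k₂ (minorPoly d 2 k₂ r a b) (∑ k, Finsupp.single (a k, b k) 1) := by
  classical
  set D : Equiv.Perm (Fin r) → (Fin d × Col 2 k₂) →₀ ℕ :=
    fun σ => ∑ k, Finsupp.single (a (σ k), b k) 1 with hD
  have hbinj : Function.Injective b := fun x y h => hb.injective (by simp only [h])
  have hexp : minorPoly d 2 k₂ r a b =
      ∑ σ : Equiv.Perm (Fin r), monomial (D σ) ((Equiv.Perm.sign σ : ℤ) : ℂ) := by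
    rw [minorPoly, Matrix.det_apply']
    refine Finset.sum_congr rfl fun σ _ => ?_
    have h : ∀ t : Finset (Fin r), ∏ k ∈ t, (X (a (σ k), b k) : MvP d 2 k₂) =
        monomial (∑ k ∈ t, Finsupp.single (a (σ k), b k) 1) 1 := by
      intro t
      rw [monomial_sum_one]
      rfl
    simp only [Matrix.of_apply]
    rw [h, ← map_intCast (C : ℂ →+* MvP d 2 k₂), C_mul_monomial, mul_one]
  have hDapp : ∀ σ i j c, D σ (i, j, c) = ∑ k, if (a (σ k), b k) = (i, j, c) then 1 else 0 := by
    intro σ i j c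
    simp [hD, Finsupp.finsetSum_apply, Finsupp.single_apply]
  have hDb : ∀ σ k i, D σ (i, b k) = if a (σ k) = i then 1 else 0 := by
    intro σ k i
    rw [hDapp σ i (b k).1 (b k).2, Finset.sum_eq_single k]
    · simp [Prod.ext_iff]
    · intro k' _ hk'
      rw [if_neg]
      intro h
      exact hk' (hbinj (Prod.ext_iff.1 h).2)
    · simp
  have hD0 : ∀ σ i c, c ∉ Set.range b → D σ (i, c) = 0 := by
    intro σ i c hc
    rw [hDapp σ i c.1 c.2]
    refine Finset.sum_eq_zero fun k _ => if_neg fun h => hc ⟨k, (Prod.ext_iff.1 h).2⟩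
  have hlt : ∀ σ : Equiv.Perm (Fin r), σ ≠ 1 → monLT d 2 k₂ (D σ) (D 1) := by
    intro σ hσ
    obtain ⟨k, hk, hmin⟩ := (Finset.univ.filter fun k => σ k ≠ k).exists_min_image id (by
      obtain ⟨k, hk⟩ := not_forall.1 fun h => hσ (Equiv.ext h)
      exact ⟨k, by simpa using hk⟩)
    have hfix : ∀ k' < k, σ k' = k' := by
      intro k' hk'
      by_contra hne
      exact absurd (hmin k' (by simpa using hne)) (not_le.2 hk')
    have hkσ : k < σ k := by
      refine lt_of_le_of_ne (not_lt.1 fun h => ?_) (Ne.symm (Finset.mem_filter.1 hk).2)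
      exact (Finset.mem_filter.1 hk).2 (σ.injective (hfix _ h))
    refine ⟨(a k, b k), ?_, ?_⟩
    · rintro ⟨i, c⟩ hw
      by_cases hc : c ∈ Set.range b
      · obtain ⟨k', rfl⟩ := hc
        rw [hDb, hDb]
        have hcol : k' < k ∨ (k' = k ∧ i < a k) := by
          simp only [varLT, Prod.lex_def, Fin.lt_def, Fin.ext_iff] at hw
          rcases lt_trichotomy k' k with h | h | h
          · exact Or.inl h
          · subst h
            right
            simp only [Fin.lt_def]
            exact ⟨trivial, by omega⟩
          · have := hb h
            have := (b k).1.isLt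
            have := (b k').1.isLt
            simp only at *
            omega
        rcases hcol with h | ⟨rfl, h⟩
        · rw [hfix k' h]
          rfl
        · rw [if_neg (h.trans (ha hkσ)).ne', if_neg]
          exact h.ne'
      · rw [hD0 _ _ _ hc, hD0 _ _ _ hc]
    · rw [hDb, hDb, if_neg (ha hkσ).ne']
      simp
  have hinj : ∀ σ, D σ = D 1 → σ = 1 := by
    intro σ h
    by_contra hne
    obtain ⟨v, -, hv⟩ := hlt σ hne
    rw [h] at hv
    exact lt_irrefl _ hv
  change IsLeadMon d 2 k₂ _ (D 1)
  constructor
  · rw [mem_support_iff, hexp, coeff_sum, Finset.sum_eq_single 1]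
    · simp
    · intro σ _ hσ
      rw [coeff_monomial, if_neg fun h => hσ (hinj σ h)]
    · simp
  · intro m' hm'
    rw [hexp] at hm'
    obtain ⟨σ, -, hσ⟩ := Finset.mem_biUnion.1 (support_sum hm')
    rw [Finset.mem_singleton.1 (support_monomial_subset hσ)]
    by_cases h : σ = 1
    · exact Or.inl (by rw [h])
    · exact Or.inr (hlt σ h)

/-- A matrix factoring through fewer than `n` intermediate indices has vanishing determinant. -/
lemma det_sum_mul_eq_zero {n : ℕ} (K : Finset ℕ) (hK : K.card < n) (A B : ℕ → Fin n → ℂ) :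
    (Matrix.of fun i j => ∑ k ∈ K, A k i * B k j : Matrix (Fin n) (Fin n) ℂ).det = 0 := by
  set P : Matrix (Fin n) K ℂ := Matrix.of fun i k => A k i
  set Q : Matrix K (Fin n) ℂ := Matrix.of fun k j => B k j
  have hPQ : (Matrix.of fun i j => ∑ k ∈ K, A k i * B k j : Matrix (Fin n) (Fin n) ℂ) = P * Q := by
    ext i j
    rw [Matrix.mul_apply, Matrix.of_apply, ← Finset.sum_coe_sort]
    rfl
  rw [hPQ]
  by_contra hdet
  have h₁ := Matrix.rank_of_isUnit (P * Q)
    ((Matrix.isUnit_iff_isUnit_det _).2 (isUnit_iff_ne_zero.2 hdet))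
  have h₂ := (Matrix.rank_mul_le_left P Q).trans P.rank_le_card_width
  rw [Fintype.card_coe] at h₂
  rw [Fintype.card_fin] at h₁
  omega

/-- If the coordinates of a curve grow at most like exponentials with prescribed rates, with
equality on the support of the heaviest monomial of `f`, then `f` does not vanish on the curve. -/
lemma exists_eval_ne_zero {σ : Type*} [Fintype σ] (f : MvPolynomial σ ℂ) {m : σ →₀ ℕ}
    (hm : m ∈ f.support) (W : σ → ℝ)
    (hW : ∀ m' ∈ f.support, m' ≠ m → ∑ v, m' v * W v < ∑ v, m v * W v)
    (g : ℝ → σ → ℂ) (n : σ → ℂ)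
    (hg : ∀ v, Filter.Tendsto (fun s => g s v * Real.exp (-(s * W v))) Filter.atTop (nhds (n v)))
    (hn : ∀ v, m v ≠ 0 → n v ≠ 0) : ∃ s, eval (g s) f ≠ 0 := by
  by_contra! hzero
  set w : (σ →₀ ℕ) → ℝ := fun m' => ∑ v, m' v * W v
  have hlim : Filter.Tendsto
      (fun s => ∑ m' ∈ f.support, f.coeff m' * ((Real.exp (s * (w m' - w m)) : ℂ) *
        ∏ v, (g s v * Real.exp (-(s * W v))) ^ m' v)) Filter.atTop
      (nhds (∑ m' ∈ f.support, f.coeff m' * ((if m' = m then 1 else 0) * ∏ v, n v ^ m' v))) := by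
    refine tendsto_finsetSum _ fun m' hm' => tendsto_const_nhds.mul (Filter.Tendsto.mul ?_ ?_)
    · split_ifs with h
      · simp [h]
      · have hneg : w m' - w m < 0 := sub_neg.2 (hW m' hm' h)
        have := Real.tendsto_exp_atBot.comp (Filter.tendsto_id.atTop_mul_const_of_neg hneg)
        exact_mod_cast (Complex.continuous_ofReal.tendsto 0).comp this
    · exact tendsto_finsetProd _ fun v _ => (hg v).pow _
  have heq : ∀ s, ∑ m' ∈ f.support, f.coeff m' * ((Real.exp (s * (w m' - w m)) : ℂ) *
        ∏ v, (g s v * Real.exp (-(s * W v))) ^ m' v) = 0 := by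
    intro s
    have hfac : ∀ m' : σ →₀ ℕ, (Real.exp (s * (w m' - w m)) : ℂ) *
        ∏ v, (g s v * Real.exp (-(s * W v))) ^ m' v =
        Real.exp (-(s * w m)) * ∏ v, g s v ^ m' v := by
      intro m'
      have h : ∏ v, (Real.exp (-(s * W v)) : ℂ) ^ m' v = Real.exp (-(s * w m')) := by
        rw [Finset.mul_sum, ← Finset.sum_neg_distrib, Real.exp_sum]
        push_cast
        refine Finset.prod_congr rfl fun v _ => ?_
        rw [← Complex.exp_nat_mul]
        congr 1
        ring
      simp only [mul_pow, Finset.prod_mul_distrib, h]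
      rw [mul_left_comm, ← Complex.ofReal_mul, ← Real.exp_add, mul_comm]
      congr 3
      ring
    have hz := hzero s
    rw [eval_eq'] at hz
    calc _ = (Real.exp (-(s * w m)) : ℂ) * ∑ m' ∈ f.support, f.coeff m' * ∏ v, g s v ^ m' v := by
          rw [Finset.mul_sum]
          refine Finset.sum_congr rfl fun m' _ => ?_
          rw [hfac, mul_left_comm]
      _ = 0 := by rw [hz, mul_zero]
  simp only [heq] at hlim
  have h0 := tendsto_nhds_unique hlim tendsto_const_nhds
  rw [Finset.sum_eq_single m (fun m' _ h => by simp [h]) (fun h => absurd hm h)] at h0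
  simp only [if_true, one_mul, mul_eq_zero] at h0
  rcases h0 with h0 | h0
  · exact mem_support_iff.1 hm h0
  · obtain ⟨v, -, hv⟩ := Finset.prod_eq_zero_iff.1 h0
    exact hn v (fun h => by simp [h] at hv) (eq_zero_of_pow_eq_zero hv)

lemma NWChain.exists_enum {C : Finset (ℕ × ℕ)} (hC : NWChain C) :
    ∃ x : Fin C.card → ℕ × ℕ, (∀ k, x k ∈ C) ∧ ∀ k k', k < k' → NW (x k) (x k') := by
  classical
  have hinj : Set.InjOn Prod.fst (C : Set (ℕ × ℕ)) := by
    intro x hx y hy hxy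
    by_contra hne
    rcases hC x hx y hy hne with h | h <;> have := h.1 <;> omega
  have hcard : (C.image Prod.fst).card = C.card := Finset.card_image_of_injOn hinj
  have hx : ∀ k, ∃ x ∈ C, x.1 = (C.image Prod.fst).orderEmbOfFin hcard k := fun k =>
    Finset.mem_image.1 ((C.image Prod.fst).orderEmbOfFin_mem hcard k)
  choose x hxC hx using hx
  refine ⟨x, hxC, fun k k' hk => ?_⟩
  have hlt : (x k).1 < (x k').1 := by
    rw [hx, hx]
    exact ((C.image Prod.fst).orderEmbOfFin hcard).strictMono hk
  rcases hC _ (hxC k) _ (hxC k') (fun h => by rw [h] at hlt; omega) with h | h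
  · exact h
  · have := h.1
    omega

/-- The weights `δ ^ (c * d + i)` form a Monge array. -/
lemma pow_monge {δ : ℝ} (hδ0 : 0 < δ) (hδ2 : δ ≤ 1 / 2) {d : ℕ} (hd : 0 < d) {i i' c c' : ℕ}
    (hi : i ≤ i') (hc : c < c') :
    δ ^ (c * d + i') + δ ^ (c' * d + i) ≤ δ ^ (c * d + i) + δ ^ (c' * d + i') := by
  rcases hi.eq_or_lt with rfl | hi
  · rfl
  · have hcd : c * d + d ≤ c' * d := by
      rw [← Nat.succ_mul]
      exact Nat.mul_le_mul_right d hc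
    have h₁ : δ ^ (c * d + i') ≤ δ ^ (c * d + i + 1) :=
      pow_le_pow_of_le_one hδ0.le (by linarith) (by omega)
    have h₂ : δ ^ (c' * d + i) ≤ δ ^ (c * d + i + 1) :=
      pow_le_pow_of_le_one hδ0.le (by linarith) (by omega)
    have h₃ := pow_pos hδ0 (c * d + i)
    have h₄ := pow_pos hδ0 (c' * d + i')
    rw [pow_succ] at h₁ h₂
    nlinarith

/-- The rank-one summands available in column slice `l`. -/
def levels (lo hi q r l : ℕ) : Finset ℕ :=
  if l < lo then Finset.range (r + 1)
  else if l < hi then Finset.Ico q (r + 1) else Finset.Ico q (r + 1 + q)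

/-- There is a curve of points whose columns satisfying `NF` are combinations of the vectors
indexed by `levels`, and whose coordinates grow at most at the exponential rates `δ ^ varIdx`, with
equality on the support of `m`, provided that the cells of
the support of `m` in the columns satisfying `NF` contain no long chains. -/
lemma exists_curve {d k₂ : ℕ} (hd : 0 < d) {δ : ℝ} (hδ0 : 0 < δ) (hδ2 : δ ≤ 1 / 2)
    (m : (Fin d × Col 2 k₂) →₀ ℕ) (NF : Col 2 k₂ → Prop) {lo hi r : ℕ} (hlh : lo ≤ hi)
    (hpair : ∀ i i' l, NF (0, l) → NF (1, l) → m (i, (0, l)) ≠ 0 → m (i', (1, l)) ≠ 0 → i' ≤ i)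
    (hchain : ∀ (n : ℕ) (a : Fin n → Fin d) (b : Fin n → Col 2 k₂), StrictMono a →
      StrictMono (fun k => (b k).2) → (∀ k, NF (b k) ∧ m (a k, b k) ≠ 0) →
      ((∀ k, lo ≤ ((b k).2 : ℕ) ∧ ((b k).2 : ℕ) < hi) → n ≤ r) ∧
      ((∀ k, ((b k).2 : ℕ) < hi) → n ≤ r + 1) ∧ ((∀ k, lo ≤ ((b k).2 : ℕ)) → n ≤ r + 1)) :
    ∃ q, 1 ≤ q ∧ ∃ (g : ℝ → Fin d × Col 2 k₂ → ℂ) (n : Fin d × Col 2 k₂ → ℂ)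
      (T : ℝ → Col 2 k₂ → ℂ) (A B : ℝ → ℕ → ℕ → ℂ),
      (∀ v, Filter.Tendsto (fun s => g s v * Real.exp (-(s * δ ^ varIdx d k₂ v))) Filter.atTop
        (nhds (n v))) ∧ (∀ v, m v ≠ 0 → n v ≠ 0) ∧
      ∀ s i c, NF c → g s (i, c) = T s c * ∑ k ∈ levels lo hi q r c.2, A s k i * B s k c.2 := by
  classical
  set W : ℕ → ℕ → ℕ → ℝ := fun i j l => δ ^ ((2 * l + j) * d + i) with hW
  have hWv : ∀ i : Fin d, ∀ c : Col 2 k₂, δ ^ varIdx d k₂ (i, c) = W i c.1 c.2 := fun i c => rfl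
  set G : Finset (ℕ × ℕ) :=
    (m.support.filter fun v => NF v.2).image fun v => ((v.1 : ℕ), (v.2.2 : ℕ)) with hG
  have hGmem : ∀ x ∈ G, ∃ (i : Fin d) (c : Col 2 k₂), NF c ∧ m (i, c) ≠ 0 ∧
      x = ((i : ℕ), (c.2 : ℕ)) := by
    intro x hx
    obtain ⟨⟨i, c⟩, hv, rfl⟩ := Finset.mem_image.1 hx
    rw [Finset.mem_filter, Finsupp.mem_support_iff] at hv
    exact ⟨i, c, hv.2, hv.1, rfl⟩
  have hmemG : ∀ (i : Fin d) (c : Col 2 k₂), NF c → m (i, c) ≠ 0 → ((i : ℕ), (c.2 : ℕ)) ∈ G :=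
    fun i c hc hm => Finset.mem_image.2
      ⟨(i, c), Finset.mem_filter.2 ⟨Finsupp.mem_support_iff.2 hm, hc⟩, rfl⟩
  have hGchain : ∀ C ⊆ G, NWChain C →
      ((∀ x ∈ C, lo ≤ x.2 ∧ x.2 < hi) → C.card ≤ r) ∧
      ((∀ x ∈ C, x.2 < hi) → C.card ≤ r + 1) ∧ ((∀ x ∈ C, lo ≤ x.2) → C.card ≤ r + 1) := by
    intro C hCG hC
    obtain ⟨x, hxC, hx⟩ := hC.exists_enum
    choose a b hNF hmab hxab using fun k => hGmem (x k) (hCG (hxC k))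
    have hb : ∀ k, ((b k).2 : ℕ) = (x k).2 := fun k => by rw [hxab k]
    have ha : ∀ k, (a k : ℕ) = (x k).1 := fun k => by rw [hxab k]
    obtain ⟨h₁, h₂, h₃⟩ := hchain C.card a b
      (fun k k' hk => by rw [Fin.lt_def, ha, ha]; exact (hx k k' hk).1)
      (fun k k' hk => by change (b k).2 < (b k').2; rw [Fin.lt_def, hb, hb]; exact (hx k k' hk).2)
      fun k => ⟨hNF k, hmab k⟩
    simp only [hb] at h₁ h₂ h₃
    exact ⟨fun h => h₁ fun k => h _ (hxC k), fun h => h₂ fun k => h _ (hxC k),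
      fun h => h₃ fun k => h _ (hxC k)⟩
  obtain ⟨q, hq, lam, hlam, hrange⟩ := exists_level G hlh (fun C h h' => (hGchain C h h').1)
    (fun C h h' => (hGchain C h h').2.1) (fun C h h' => (hGchain C h h').2.2)
  have hmonge : ∀ {i i' j j' l l' : ℕ}, i ≤ i' → 2 * l + j < 2 * l' + j' →
      W i' j l + W i j' l' ≤ W i j l + W i' j' l' := fun hi hc => pow_monge hδ0 hδ2 hd hi hc
  have hτ : ∀ l : ℕ, ∃ τ : ℝ, ∀ (i : Fin d) (l' : Fin k₂), (l' : ℕ) = l →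
      (NF (0, l') → m (i, (0, l')) ≠ 0 → τ ≤ W i 1 l - W i 0 l) ∧
      (NF (1, l') → m (i, (1, l')) ≠ 0 → W i 1 l - W i 0 l ≤ τ) := by
    intro l
    by_cases hl : l < k₂
    swap
    · exact ⟨0, fun i l' h => absurd l'.isLt (by omega)⟩
    obtain ⟨l, rfl⟩ : ∃ l' : Fin k₂, (l' : ℕ) = l := ⟨⟨l, hl⟩, rfl⟩
    rcases (Finset.univ.filter fun i => NF (1, l) ∧ m (i, (1, l)) ≠ 0).eq_empty_or_nonempty
      with he | hne
    · obtain ⟨i₀, -, hmin⟩ := (Finset.univ : Finset (Fin d)).exists_min_image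
        (fun i => W i 1 l - W i 0 l) ⟨⟨0, hd⟩, Finset.mem_univ _⟩
      refine ⟨W i₀ 1 l - W i₀ 0 l, fun i l' h => ?_⟩
      obtain rfl := Fin.ext h
      refine ⟨fun _ _ => hmin i (Finset.mem_univ _), fun h₁ h₂ => ?_⟩
      have : i ∈ (∅ : Finset (Fin d)) := he ▸ Finset.mem_filter.2 ⟨Finset.mem_univ _, h₁, h₂⟩
      simp at this
    · obtain ⟨i₀, hi₀, hmax⟩ := Finset.exists_max_image _
        (fun i : Fin d => W i 1 l - W i 0 l) hne
      rw [Finset.mem_filter] at hi₀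
      refine ⟨W i₀ 1 l - W i₀ 0 l, fun i l' h => ?_⟩
      obtain rfl := Fin.ext h
      refine ⟨fun h₁ h₂ => ?_, fun h₁ h₂ =>
        hmax i (Finset.mem_filter.2 ⟨Finset.mem_univ _, h₁, h₂⟩)⟩
      have := hmonge (j := 0) (j' := 1) (l := l') (l' := l')
        (hpair i i₀ l' h₁ hi₀.2.1 h₂ hi₀.2.2) (by omega)
      linarith
  choose τ hτ using hτ
  set V : ℕ → ℕ → ℝ := fun i l => min (W i 0 l) (W i 1 l - τ l) with hV
  have hVmonge : ∀ i c c', c ≤ c' → V i c' - V (i + 1) c' ≤ V i c - V (i + 1) c := by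
    intro i c c' hcc
    rcases hcc.eq_or_lt with rfl | hcc
    · rfl
    have h00 := hmonge (j := 0) (j' := 0) (l := c) (l' := c') (Nat.le_succ i) (by omega)
    have h01 := hmonge (j := 0) (j' := 1) (l := c) (l' := c') (Nat.le_succ i) (by omega)
    have h10 := hmonge (j := 1) (j' := 0) (l := c) (l' := c') (Nat.le_succ i) (by omega)
    have h11 := hmonge (j := 1) (j' := 1) (l := c) (l' := c') (Nat.le_succ i) (by omega)
    have a₁ : V (i + 1) c ≤ _ := min_le_left _ _
    have a₂ : V (i + 1) c ≤ _ := min_le_right _ _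
    have b₁ : V i c' ≤ _ := min_le_left _ _
    have b₂ : V i c' ≤ _ := min_le_right _ _
    rcases min_choice (W i 0 c) (W i 1 c - τ c) with h | h <;>
    rcases min_choice (W (i + 1) 0 c') (W (i + 1) 1 c' - τ c') with h' | h' <;>
    · change V i c = _ at h
      change V (i + 1) c' = _ at h'
      simp only [Nat.succ_eq_add_one] at *
      linarith
  choose α β hαβ htight using fun k => exists_potential V hVmonge d (G.filter (lam · = k)) (by
    intro x hx y hy hxy
    rw [Finset.mem_filter] at hx hy
    have := hlam x hx.1 y hy.1 hxy
    omega)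
  set τ' : Col 2 k₂ → ℝ := fun c => if c.1 = 0 then 0 else τ c.2 with hτ'
  have hcase : ∀ j : Fin 2, j = 0 ∨ j = 1 := by decide
  have hVle : ∀ (i : Fin d) (c : Col 2 k₂), V i c.2 + τ' c ≤ W i c.1 c.2 := by
    rintro i ⟨j, l⟩
    rcases hcase j with rfl | rfl
    · simp [hV, hτ']
    · have : V i l ≤ W i 1 l - τ l := min_le_right _ _
      simp only [hτ', Fin.val_one]
      rw [if_neg (by decide)]
      linarith
  have hVeq : ∀ (i : Fin d) (c : Col 2 k₂), NF c → m (i, c) ≠ 0 →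
      V i c.2 + τ' c = W i c.1 c.2 := by
    rintro i ⟨j, l⟩ hc hm
    rcases hcase j with rfl | rfl
    · have h := (hτ l i l rfl).1 hc hm
      have : V i l = W i 0 l := min_eq_left (by linarith)
      simp [hτ', this]
    · have h := (hτ l i l rfl).2 hc hm
      have : V i l = W i 1 l - τ l := min_eq_right (by linarith)
      simp [hτ', this]
  have hlim : ∀ x : ℝ, x ≤ 0 → Filter.Tendsto (fun s : ℝ => (Real.exp (s * x) : ℂ)) Filter.atTop
      (nhds (if x = 0 then 1 else 0)) := by
    intro x hx
    split_ifs with h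
    · simp [h]
    · have := Real.tendsto_exp_atBot.comp
        (Filter.tendsto_id.atTop_mul_const_of_neg (lt_of_le_of_ne hx h))
      exact_mod_cast (Complex.continuous_ofReal.tendsto 0).comp this
  set K := levels lo hi q r
  refine ⟨q, hq, fun s v => if NF v.2 then (Real.exp (s * τ' v.2) : ℂ) * ∑ k ∈ K v.2.2,
      (Real.exp (s * α k v.1) : ℂ) * Real.exp (s * β k v.2.2)
      else Real.exp (s * δ ^ varIdx d k₂ v),
    fun v => if NF v.2 then ∑ k ∈ K v.2.2,
      (if τ' v.2 + (α k v.1 + β k v.2.2) - W v.1 v.2.1 v.2.2 = 0 then 1 else 0) else 1,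
    fun s c => Real.exp (s * τ' c), fun s k i => Real.exp (s * α k i),
    fun s k l => Real.exp (s * β k l), ?_, ?_, ?_⟩
  · rintro ⟨i, c⟩
    by_cases hc : NF c
    · simp only [if_pos hc, hWv]
      have : ∀ s : ℝ, (Real.exp (s * τ' c) : ℂ) * (∑ k ∈ K c.2, (Real.exp (s * α k i) : ℂ) *
          Real.exp (s * β k c.2)) * Real.exp (-(s * W i c.1 c.2)) =
          ∑ k ∈ K c.2, (Real.exp (s * (τ' c + (α k i + β k c.2) - W i c.1 c.2)) : ℂ) := by
        intro s
        rw [Finset.mul_sum, Finset.sum_mul]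
        refine Finset.sum_congr rfl fun k _ => ?_
        rw [← Complex.ofReal_mul, ← Complex.ofReal_mul, ← Complex.ofReal_mul, ← Real.exp_add,
          ← Real.exp_add, ← Real.exp_add]
        congr 2
        ring
      simp only [this]
      refine tendsto_finsetSum _ fun k _ => hlim _ ?_
      have h₁ := hαβ k i i.isLt c.2
      have h₂ := hVle i c
      linarith
    · simp only [if_neg hc]
      have : ∀ s : ℝ, (Real.exp (s * δ ^ varIdx d k₂ (i, c)) : ℂ) *
          Real.exp (-(s * δ ^ varIdx d k₂ (i, c))) = 1 := by
        intro s
        rw [← Complex.ofReal_mul, ← Real.exp_add]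
        simp
      simp only [this]
      exact tendsto_const_nhds
  · rintro ⟨i, c⟩ hm
    by_cases hc : NF c
    · simp only [if_pos hc]
      rw [Finset.sum_boole, Nat.cast_ne_zero, ← Nat.pos_iff_ne_zero, Finset.card_pos]
      have hx := hmemG i c hc hm
      refine ⟨lam (i, c.2), Finset.mem_filter.2 ⟨?_, ?_⟩⟩
      · obtain ⟨h₁, h₂, h₃⟩ := hrange _ hx
        simp only [K, levels]
        split_ifs with h h'
        · exact Finset.mem_range.2 (h₁ h)
        · exact Finset.mem_Ico.2 (h₂ (by simpa using h) h')
        · exact Finset.mem_Ico.2 (h₃ (by simpa using h'))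
      · have h₁ := htight (lam (i, c.2)) (i, c.2) (Finset.mem_filter.2 ⟨hx, rfl⟩) i.isLt
        have h₂ := hVeq i c hc hm
        simp only at h₁
        linarith
    · simp [hc]
  · intro s i c hc
    simp only [if_pos hc, K]

/-- A minor vanishes if its columns are combinations of fewer than `n` common vectors
`A l`, `l ∈ K`. -/
lemma eval_minorPoly_eq_zero {d k₂ n : ℕ} (K : Finset ℕ) (hK : K.card < n) {x : Fin d × Col 2 k₂ → ℂ}
    {L : ℕ → Finset ℕ} {T : Col 2 k₂ → ℂ} {A B : ℕ → ℕ → ℂ} (a : Fin n → Fin d)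
    (b : Fin n → Col 2 k₂) (hL : ∀ k, L (b k).2 ⊆ K)
    (hx : ∀ i k, x (i, b k) = T (b k) * ∑ l ∈ L (b k).2, A l i * B l (b k).2) :
    eval x (minorPoly d 2 k₂ n a b) = 0 := by
  classical
  rw [minorPoly, RingHom.map_det]
  rw [← det_sum_mul_eq_zero K hK (fun l i => A l (a i))
    (fun l k => if l ∈ L (b k).2 then T (b k) * B l (b k).2 else 0)]
  congr 1
  ext i k
  simp only [RingHom.mapMatrix_apply, Matrix.map_apply, Matrix.of_apply, eval_X, hx, mul_ite,
    mul_zero]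
  rw [Finset.sum_ite_mem, Finset.inter_eq_right.2 (hL k), Finset.mul_sum]
  exact Finset.sum_congr rfl fun l _ => by ring

lemma sum_single_le {d k₂ n : ℕ} {m : (Fin d × Col 2 k₂) →₀ ℕ} {a : Fin n → Fin d}
    {b : Fin n → Col 2 k₂} (ha : Function.Injective a) (hm : ∀ k, m (a k, b k) ≠ 0)
    (x : Fin d × Col 2 k₂) : (∑ k, Finsupp.single (a k, b k) 1 : _ →₀ ℕ) x ≤ m x := by
  classical
  rw [Finsupp.finsetSum_apply]
  by_cases hx : ∃ k, (a k, b k) = x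
  · obtain ⟨k, rfl⟩ := hx
    rw [Finset.sum_eq_single k, Finsupp.single_eq_same]
    · exact Nat.one_le_iff_ne_zero.2 (hm k)
    · intro k' _ hk'
      exact Finsupp.single_eq_of_ne fun h => hk' (ha (congrArg Prod.fst h).symm)
    · simp
  · rw [Finset.sum_eq_zero]
    · exact Nat.zero_le _
    · intro k _
      exact Finsupp.single_eq_of_ne fun h => hx ⟨k, h.symm⟩

/-- If no minor of size `N` in the columns `U` has leading monomial dividing `m`, then chains of
cells of the support of `m` in the columns `U` have length less than `N`. -/
lemma lt_of_forall_not_le {d k₂ N : ℕ} {U : Set (Col 2 k₂)} {m : (Fin d × Col 2 k₂) →₀ ℕ}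
    (hno : ∀ g ∈ minorSet d 2 k₂ N U, ∀ mg, IsLeadMon d 2 k₂ g mg → ¬ ∀ x, mg x ≤ m x)
    {n : ℕ} {a : Fin n → Fin d} {b : Fin n → Col 2 k₂} (ha : StrictMono a)
    (hb : StrictMono fun k => 2 * ((b k).2 : ℕ) + (b k).1) (hU : ∀ k, b k ∈ U)
    (hm : ∀ k, m (a k, b k) ≠ 0) : n < N := by
  by_contra! h
  have hc : StrictMono (Fin.castLE h) := Fin.strictMono_castLE h
  have hb' : Function.Injective (b ∘ Fin.castLE h) := fun k k' hk =>
    (hb.comp hc).injective (by simp only [Function.comp] at hk ⊢; rw [hk])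
  exact hno _ ⟨a ∘ Fin.castLE h, b ∘ Fin.castLE h, (ha.comp hc).injective, hb',
    fun k => hU _, rfl⟩ _ (isLeadMon_minorPoly (ha.comp hc) (hb.comp hc))
    (sum_single_le (ha.comp hc).injective fun k => hm _)

/-- for `k₁ = 2`, `2 ≤ t ≤ min(k₂, d)`, `1 ≤ u ≤ v ≤ k₂ − t + 1`
(with `u + v = k₂` if `t = 2`), and `S = {1}×{1,…,u} ∪ {2}×{k₂−v+1,…,k₂}`, the set
`F(J_S)` is a Gröbner basis of the ideal `J_S` it generates, with respect to `≺`. -/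
theorem FJS_isGB
    (d k₂ t u v : ℕ) (ht : 2 ≤ t) (htk : t ≤ k₂) (htd : t ≤ d)
    (hu : 1 ≤ u) (huv : u ≤ v) (hv : v ≤ k₂ - t + 1) (ht2 : t = 2 → u + v = k₂) :
    let S : Set (Col 2 k₂) :=
      { p | (p.1 = 0 ∧ (p.2 : ℕ) < u) ∨ (p.1 = 1 ∧ k₂ - v ≤ (p.2 : ℕ)) }
    let FJ : Set (MvP d 2 k₂) :=
      (⋃ j ∈ { j : Fin k₂ | colOK k₂ S j }, minorSet d 2 k₂ 2 (colSlice 2 k₂ j)) ∪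
        minorSet d 2 k₂ (t - 1) (CSet k₂ S) ∪
        minorSet d 2 k₂ t ((rowSlice 2 k₂ 0 \ S) ∪ CSet k₂ S) ∪
        minorSet d 2 k₂ t ((rowSlice 2 k₂ 1 \ S) ∪ CSet k₂ S)
    IsGB d 2 k₂ FJ (Ideal.span FJ) := by
  intro S FJ
  refine ⟨Ideal.subset_span, fun f hf hf0 => ?_⟩
  obtain ⟨m, hm, huniq, δ, hδ0, hδ2, hW⟩ := exists_isLeadMon hf0
  by_contra hcon
  have hno : ∀ g ∈ FJ, ∀ mg, IsLeadMon d 2 k₂ g mg → ¬ ∀ x, mg x ≤ m x :=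
    fun g hg mg hmg hle => hcon ⟨g, hg, mg, hmg, fun mf hmf => huniq mf hmf ▸ hle⟩
  have hS0 : ∀ l, ((0 : Fin 2), l) ∉ S ↔ u ≤ (l : ℕ) := by simp [S]
  have hS1 : ∀ l, ((1 : Fin 2), l) ∉ S ↔ (l : ℕ) < k₂ - v := by
    simp [S, Nat.lt_sub_iff_add_lt]
  have hcase : ∀ j : Fin 2, j = 0 ∨ j = 1 := by decide
  have hOK : ∀ l, colOK k₂ S l ↔ u ≤ (l : ℕ) ∧ (l : ℕ) < k₂ - v := fun l => by
    rw [colOK, Fin.forall_fin_two, hS0, hS1]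
  have hsub2 : ∀ l, colOK k₂ S l → minorSet d 2 k₂ 2 (colSlice 2 k₂ l) ⊆ FJ := fun l hl g hg =>
    Or.inl (Or.inl (Or.inl (Set.mem_biUnion hl hg)))
  have hsubC : minorSet d 2 k₂ (t - 1) (CSet k₂ S) ⊆ FJ := fun g hg => Or.inl (Or.inl (Or.inr hg))
  have hsub0 : minorSet d 2 k₂ t ((rowSlice 2 k₂ 0 \ S) ∪ CSet k₂ S) ⊆ FJ := fun g hg =>
    Or.inl (Or.inr hg)
  have hsub1 : minorSet d 2 k₂ t ((rowSlice 2 k₂ 1 \ S) ∪ CSet k₂ S) ⊆ FJ := fun g hg => Or.inr hg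
  have hU0 : ∀ c ∈ (rowSlice 2 k₂ 0 \ S) ∪ CSet k₂ S, c ∉ S ∧ u ≤ (c.2 : ℕ) := by
    rintro ⟨j, l⟩ (⟨rfl, h⟩ | h)
    · exact ⟨h, (hS0 l).1 h⟩
    · exact ⟨h j, ((hOK l).1 h).1⟩
  have hU1 : ∀ c ∈ (rowSlice 2 k₂ 1 \ S) ∪ CSet k₂ S, c ∉ S ∧ (c.2 : ℕ) < k₂ - v := by
    rintro ⟨j, l⟩ (⟨rfl, h⟩ | h)
    · exact ⟨h, (hS1 l).1 h⟩
    · exact ⟨h j, ((hOK l).1 h).2⟩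
  set lo := min u (k₂ - v) with hlo
  set hi := max u (k₂ - v) with hhi
  have hmid : ∀ c ∉ S, lo ≤ (c.2 : ℕ) → (c.2 : ℕ) < hi → c ∈ CSet k₂ S := by
    rintro ⟨j, l⟩ hc h₁ h₂
    refine (hOK l).2 ?_
    rcases hcase j with rfl | rfl
    · have := (hS0 l).1 hc
      simp only at h₁ h₂
      omega
    · have := (hS1 l).1 hc
      simp only at h₁ h₂
      omega
  have hmem0 : ∀ c ∉ S, lo ≤ (c.2 : ℕ) → c ∈ (rowSlice 2 k₂ 0 \ S) ∪ CSet k₂ S := by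
    rintro ⟨j, l⟩ hc h
    rcases hcase j with rfl | rfl
    · exact Or.inl ⟨rfl, hc⟩
    · have := (hS1 l).1 hc
      exact Or.inr (hmid _ hc h (by simp only; omega))
  have hmem1 : ∀ c ∉ S, (c.2 : ℕ) < hi → c ∈ (rowSlice 2 k₂ 1 \ S) ∪ CSet k₂ S := by
    rintro ⟨j, l⟩ hc h
    rcases hcase j with rfl | rfl
    · have := (hS0 l).1 hc
      exact Or.inr (hmid _ hc (by simp only; omega) h)
    · exact Or.inl ⟨rfl, hc⟩
  obtain ⟨q, hq, g, n, T, A, B, hg, hn, hgT⟩ := exists_curve (by omega : 0 < d) hδ0 hδ2 m (· ∉ S)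
    (lo := lo) (hi := hi) (r := t - 2) (by omega)
    (by
      intro i i' l h₀ h₁ hm₀ hm₁
      by_contra! hlt
      refine lt_irrefl 2 (lt_of_forall_not_le (fun g hg => hno g (hsub2 l ?_ hg))
        (a := ![i, i']) (b := ![(0, l), (1, l)]) ?_ ?_ ?_ ?_)
      · exact (hOK l).2 ⟨(hS0 l).1 h₀, (hS1 l).1 h₁⟩
      · rw [Fin.strictMono_iff_lt_succ]
        simpa [Fin.forall_fin_one] using hlt
      · rw [Fin.strictMono_iff_lt_succ]
        simp
      · simp [Fin.forall_fin_two, colSlice]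
      · simpa [Fin.forall_fin_two] using ⟨hm₀, hm₁⟩)
    (by
      intro n a b ha hb h
      have hb' : StrictMono fun k => 2 * ((b k).2 : ℕ) + (b k).1 := by
        intro k k' hk
        have h₁ : ((b k).2 : ℕ) < (b k').2 := hb hk
        have h₂ := (b k).1.isLt
        simp only
        omega
      refine ⟨fun h' => ?_, fun h' => ?_, fun h' => ?_⟩
      · have := lt_of_forall_not_le (fun g hg => hno g (hsubC hg)) ha hb'
          (fun k => hmid _ (h k).1 (h' k).1 (h' k).2) fun k => (h k).2
        omega
      · have := lt_of_forall_not_le (fun g hg => hno g (hsub1 hg)) ha hb'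
          (fun k => hmem1 _ (h k).1 (h' k)) fun k => (h k).2
        omega
      · have := lt_of_forall_not_le (fun g hg => hno g (hsub0 hg)) ha hb'
          (fun k => hmem0 _ (h k).1 (h' k)) fun k => (h k).2
        omega)
  have hvan : ∀ s, ∀ p ∈ FJ, eval (g s) p = 0 := by
    rintro s p (((hp | ⟨a, b, -, -, hb, rfl⟩) | ⟨a, b, -, -, hb, rfl⟩) | ⟨a, b, -, -, hb, rfl⟩)
    · obtain ⟨l, hl, a, b, -, -, hb, rfl⟩ := Set.mem_iUnion₂.1 hp
      have hb : ∀ k, (b k).2 = l := hb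
      refine eval_minorPoly_eq_zero {0} (by simp) (L := fun _ => {0}) (T := T s)
        (A := fun _ i => ∑ k ∈ levels lo hi q (t - 2) l, A s k i * B s k l) (B := fun _ _ => 1)
        a b (fun _ => subset_rfl) fun i k => ?_
      have hbk : b k ∉ S := by
        have := hl (b k).1
        rwa [← hb k] at this
      rw [hgT s i _ hbk, hb k]
      simp
    · refine eval_minorPoly_eq_zero (Finset.Ico q (t - 2 + 1)) (by simp; omega) a b (fun k => ?_)
        fun i k => hgT s i _ (hb k _)
      have := (hOK _).1 (hb k)
      rw [levels, if_neg (by omega), if_pos (by omega)]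
    · refine eval_minorPoly_eq_zero (Finset.Ico q (t - 2 + 1 + q)) (by simp; omega) a b
        (fun k => ?_) fun i k => hgT s i _ (hU0 _ (hb k)).1
      have := (hU0 _ (hb k)).2
      rw [levels, if_neg (by omega)]
      split_ifs
      · exact Finset.Ico_subset_Ico_right (by omega)
      · exact subset_rfl
    · refine eval_minorPoly_eq_zero (Finset.range (t - 2 + 1)) (by simp; omega) a b
        (fun k => ?_) fun i k => hgT s i _ (hU1 _ (hb k)).1
      have := (hU1 _ (hb k)).2
      rw [levels]
      split_ifs
      · exact subset_rfl
      · intro x hx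
        exact Finset.mem_range.2 (Finset.mem_Ico.1 hx).2
      · omega
  obtain ⟨s, hs⟩ := exists_eval_ne_zero f hm _ hW g n hg hn
  have hker : Ideal.span FJ ≤ RingHom.ker (eval (g s)) := Ideal.span_le.2 fun p hp => hvan s p hp
  exact hs (hker hf)

end CI
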